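/- arXiv:2007.14025 — 8 statements merged into one kernel-verified Lean document; each statement's English description precedes it below -/
import Mathlib

section
/- Let d ≥ 1, r > 0, and let P be a probability measure on ℝ^d with ∫|x|^r dP(x) < ∞. Let Γ ⊂ ℝ^d be a nonempty finite set. Then for every probability measure ν on ℝ^d and every c ∈ (0,1/2), e_r(Γ,P)^r − inf_{y∈ℝ^d} e_r(Γ∪{y},P)^r ≥ ((1−c)^r − c^r)/(c+1)^r · ∫ ν(B(x, (c/(c+1))·d(x,Γ))) · d(x,Γ)^r dP(x). -/
open MeasureTheory Metric Set Real

/-- The `Lʳ`-quantization error `e_r(Γ, P) = (∫ d(x,Γ)^r dP(x))^(1/r)`. -/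
noncomputable def qerr {d : ℕ} (r : ℝ) (P : Measure (EuclideanSpace ℝ (Fin d)))
    (Γ : Set (EuclideanSpace ℝ (Fin d))) : ℝ :=
  (∫ x, infDist x Γ ^ r ∂P) ^ (1 / r)

lemma infDist_insert_le {α : Type*} [PseudoMetricSpace α] (x y : α) (Γ : Set α) :
    infDist x (insert y Γ) ≤ dist x y :=
  infDist_le_dist_of_mem (mem_insert y Γ)

lemma add_rpow_le_two_rpow_mul {r u v : ℝ} (hr : 0 ≤ r) (hu : 0 ≤ u) (hv : 0 ≤ v) :
    (u + v) ^ r ≤ 2 ^ r * (u ^ r + v ^ r) := by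
  have hmax : max u v ^ r ≤ u ^ r + v ^ r := by
    rcases max_choice u v with h | h <;> rw [h]
    · linarith [rpow_nonneg hv r]
    · linarith [rpow_nonneg hu r]
  calc (u + v) ^ r ≤ (2 * max u v) ^ r :=
        rpow_le_rpow (by positivity) (by linarith [le_max_left u v, le_max_right u v]) hr
    _ = 2 ^ r * max u v ^ r := mul_rpow (by norm_num) (le_max_of_le_left hu)
    _ ≤ _ := by gcongr

lemma measurable_infDist_rpow {E : Type*} [PseudoMetricSpace E] [MeasurableSpace E]
    [OpensMeasurableSpace E] (r : ℝ) (Γ : Set E) : Measurable fun x => infDist x Γ ^ r :=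
  measurable_infDist.pow_const r

lemma integrable_infDist_rpow {E : Type*} [SeminormedAddCommGroup E] [MeasurableSpace E]
    [OpensMeasurableSpace E] {r : ℝ} (hr : 0 ≤ r) {P : Measure E} [IsFiniteMeasure P]
    (hmom : Integrable (fun x => ‖x‖ ^ r) P) {Γ : Set E} (hΓ : Γ.Nonempty) :
    Integrable (fun x => infDist x Γ ^ r) P := by
  obtain ⟨a, ha⟩ := hΓ
  refine ((hmom.add (integrable_const (‖a‖ ^ r))).const_mul (2 ^ r)).mono'
    (measurable_infDist_rpow r Γ).aestronglyMeasurable (.of_forall fun x => ?_)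
  rw [norm_of_nonneg (rpow_nonneg infDist_nonneg r)]
  refine le_trans (rpow_le_rpow infDist_nonneg ?_ hr)
    (add_rpow_le_two_rpow_mul hr (norm_nonneg x) (norm_nonneg a))
  exact (infDist_le_dist_of_mem ha).trans (dist_le_norm_add_norm x a)

lemma qerr_rpow {d : ℕ} {r : ℝ} (hr : r ≠ 0) (P : Measure (EuclideanSpace ℝ (Fin d)))
    (Γ : Set (EuclideanSpace ℝ (Fin d))) : qerr r P Γ ^ r = ∫ x, infDist x Γ ^ r ∂P := by
  rw [qerr, one_div, rpow_inv_rpow (integral_nonneg fun x => rpow_nonneg infDist_nonneg r) hr]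

/-- Adding a point `y` close to `x` decreases the `r`-th power of the distance from `x` to `Γ` by
at least a fixed proportion. -/
lemma mul_infDist_rpow_le_sub_insert {α : Type*} [PseudoMetricSpace α] {r c : ℝ} (hr : 0 ≤ r)
    (hc0 : 0 ≤ c) (hc1 : c ≤ 1) {x y : α} {Γ : Set α}
    (hy : y ∈ closedBall x (c / (c + 1) * infDist x Γ)) :
    ((1 - c) ^ r - c ^ r) / (c + 1) ^ r * infDist x Γ ^ r ≤
      infDist x Γ ^ r - infDist x (insert y Γ) ^ r := by
  have hc' : 0 < (c + 1) ^ r := by positivity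
  have hle : infDist x (insert y Γ) ^ r ≤ c ^ r / (c + 1) ^ r * infDist x Γ ^ r := by
    rw [← div_rpow hc0 (by positivity), ← mul_rpow (by positivity) infDist_nonneg]
    exact rpow_le_rpow infDist_nonneg
      ((infDist_insert_le x y Γ).trans (by rwa [dist_comm, ← mem_closedBall])) hr
  have hK : ((1 - c) ^ r - c ^ r) / (c + 1) ^ r ≤ 1 - c ^ r / (c + 1) ^ r := by
    rw [sub_div]
    gcongr
    rw [div_le_one hc']
    exact rpow_le_rpow (by linarith) (by linarith) hr
  calc _ ≤ (1 - c ^ r / (c + 1) ^ r) * infDist x Γ ^ r :=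
        mul_le_mul_of_nonneg_right hK (rpow_nonneg infDist_nonneg r)
    _ ≤ _ := by linarith

/-- micro-macro inequality for an arbitrary finite quantizer. -/
theorem stmt0 (d : ℕ) (hd : 1 ≤ d) (r : ℝ) (hr : 0 < r)
    (P : Measure (EuclideanSpace ℝ (Fin d))) [IsProbabilityMeasure P]
    (hmom : Integrable (fun x => ‖x‖ ^ r) P)
    (Γ : Set (EuclideanSpace ℝ (Fin d))) (hΓfin : Γ.Finite) (hΓne : Γ.Nonempty)
    (ν : Measure (EuclideanSpace ℝ (Fin d))) [IsProbabilityMeasure ν]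
    (c : ℝ) (hc : c ∈ Set.Ioo (0 : ℝ) (1 / 2)) :
    ((1 - c) ^ r - c ^ r) / (c + 1) ^ r *
        ∫ x, (ν (closedBall x (c / (c + 1) * infDist x Γ))).toReal * infDist x Γ ^ r ∂P ≤
      qerr r P Γ ^ r - ⨅ y, qerr r P (insert y Γ) ^ r := by
  obtain ⟨hc0, hc1⟩ := hc
  simp only [qerr_rpow hr.ne']
  set K := ((1 - c) ^ r - c ^ r) / (c + 1) ^ r
  set S := {p : EuclideanSpace ℝ (Fin d) × EuclideanSpace ℝ (Fin d) |
    p.2 ∈ closedBall p.1 (c / (c + 1) * infDist p.1 Γ)}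
  have hSmeas : MeasurableSet S :=
    (isClosed_le (continuous_snd.dist continuous_fst)
      (continuous_const.mul ((continuous_infDist_pt Γ).comp continuous_fst))).measurableSet
  set F := S.indicator fun p => infDist p.1 Γ ^ r with hF
  have hint := integrable_infDist_rpow hr.le hmom hΓne
  have hFint : Integrable F (P.prod ν) := (hint.comp_fst ν).indicator hSmeas
  have hinner (x) : ∫ y, F (x, y) ∂ν =
      (ν (closedBall x (c / (c + 1) * infDist x Γ))).toReal * infDist x Γ ^ r := by
    have : (fun y => F (x, y)) = (closedBall x (c / (c + 1) * infDist x Γ)).indicator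
        fun _ => infDist x Γ ^ r := rfl
    rw [this, integral_indicator_const _ measurableSet_closedBall, smul_eq_mul, measureReal_def]
  have hbdd : BddBelow (range fun y => ∫ x, infDist x (insert y Γ) ^ r ∂P) :=
    ⟨0, by rintro _ ⟨y, rfl⟩; exact integral_nonneg fun x => rpow_nonneg infDist_nonneg r⟩
  have hgain : ∀ᵐ y ∂ν, K * ∫ x, F (x, y) ∂P ≤
      ∫ x, infDist x Γ ^ r ∂P - ⨅ y, ∫ x, infDist x (insert y Γ) ^ r ∂P := by
    filter_upwards [hFint.prod_left_ae] with y hy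
    have hinty := integrable_infDist_rpow hr.le hmom (insert_nonempty y Γ)
    refine le_trans ?_ (sub_le_sub_left (ciInf_le hbdd y) _)
    rw [← integral_const_mul, ← integral_sub hint hinty]
    refine integral_mono (hy.const_mul K) (hint.sub hinty) fun x => ?_
    by_cases hxy : (x, y) ∈ S
    · simpa only [hF, indicator_of_mem hxy] using
        mul_infDist_rpow_le_sub_insert hr.le hc0.le (by linarith) hxy
    · simpa only [hF, indicator_of_notMem hxy, mul_zero, sub_nonneg] using
        rpow_le_rpow infDist_nonneg
          (infDist_le_infDist_of_subset (subset_insert y Γ) hΓne) hr.le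
  calc K * ∫ x, (ν (closedBall x (c / (c + 1) * infDist x Γ))).toReal * infDist x Γ ^ r ∂P
      = ∫ y, K * ∫ x, F (x, y) ∂P ∂ν := by
        simp only [← hinner]
        rw [integral_const_mul, integral_integral_swap (f := fun x y => F (x, y)) hFint]
    _ ≤ ∫ _, (∫ x, infDist x Γ ^ r ∂P - ⨅ y, ∫ x, infDist x (insert y Γ) ^ r ∂P) ∂ν :=
        integral_mono_ae (hFint.integral_prod_right.const_mul K) (integrable_const _) hgain
    _ = _ := by simp
end

section
/- Let f be the density of the d-dimensional Gaussian distribution N(m,Σ): f(x) = ((2π)^d det Σ)^{−1/2} exp(−⟨x−m, Σ^{−1}(x−m)⟩/2), where Σ is a symmetric positive definite d×d matrix and m ∈ ℝ^d. Then for every θ > 0 and every real p > 1, ∫_{ℝ^d} (f(m+θ(x−m))/f(x))^p f(x) dλ_d(x) < ∞ if and only if pθ² − p + 1 > 0, i.e. if and only if θ² > 1 − 1/p. -/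
open MeasureTheory Matrix Real

open scoped MatrixOrder ComplexOrder in
/-- A real positive definite matrix factors as `Bᵀ * B` with `B` invertible. -/
theorem Matrix.PosDef.exists_transpose_mul_self {n : Type*} [Fintype n] [DecidableEq n]
    {A : Matrix n n ℝ} (hA : A.PosDef) :
    ∃ B : Matrix n n ℝ, B.det ≠ 0 ∧ A = Bᵀ * B := by
  obtain ⟨B, hB⟩ := CStarAlgebra.nonneg_iff_eq_star_mul_self.mp hA.posSemidef.nonneg
  rw [star_eq_conjTranspose, conjTranspose_eq_transpose_of_trivial] at hB
  refine ⟨B, fun h => hA.det_pos.ne' ?_, hB⟩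
  rw [hB, det_mul, h, mul_zero]

/-- A centered Gaussian function with positive definite quadratic form is integrable. -/
theorem Matrix.PosDef.integrable_exp_neg_mul {n : Type*} [Fintype n] [DecidableEq n]
    {A : Matrix n n ℝ} (hA : A.PosDef) {b : ℝ} (hb : 0 < b) :
    Integrable (fun y : n → ℝ => Real.exp (-b * (y ⬝ᵥ A *ᵥ y))) := by
  obtain ⟨B, hdet, rfl⟩ := hA.exists_transpose_mul_self
  have hg : Integrable (fun z : n → ℝ => ∏ i, Real.exp (-b * z i ^ 2)) :=
    Integrable.fintype_prod fun _ => integrable_exp_neg_mul_sq hb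
  have hmap := hg.smul_measure (c := ENNReal.ofReal |B.det⁻¹|) ENNReal.ofReal_ne_top
  rw [← Real.map_matrix_volume_pi_eq_smul_volume_pi hdet] at hmap
  have hcont : Continuous (toLin' B) := LinearMap.continuous_of_finiteDimensional _
  refine (hmap.comp_measurable hcont.measurable).congr (.of_forall fun y => ?_)
  simp only [Function.comp_apply, ← Real.exp_sum, ← Finset.mul_sum, toLin'_apply]
  rw [← mulVec_mulVec, dotProduct_mulVec, vecMul_transpose]
  simp only [dotProduct, sq]

/-- A centered Gaussian function with positive semidefinite quadratic form and nonnegative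
exponent is not integrable. -/
theorem Matrix.PosSemidef.not_integrable_exp_neg_mul {n : Type*} [Fintype n] [Nonempty n]
    {A : Matrix n n ℝ} (hA : A.PosSemidef) {b : ℝ} (hb : b ≤ 0) :
    ¬ Integrable (fun y : n → ℝ => Real.exp (-b * (y ⬝ᵥ A *ᵥ y))) := by
  intro h
  have h1 : Integrable (fun _ : n → ℝ => (1 : ℝ)) := by
    refine h.mono' aestronglyMeasurable_const (.of_forall fun y => ?_)
    have hy : 0 ≤ y ⬝ᵥ A *ᵥ y := by simpa using hA.dotProduct_mulVec_nonneg y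
    rw [norm_one]
    exact Real.one_le_exp (mul_nonneg (neg_nonneg.2 hb) hy)
  rw [integrable_const_iff_isFiniteMeasure one_ne_zero] at h1
  exact (measure_lt_top (volume : Measure (n → ℝ)) Set.univ).ne
    (measure_univ_of_isAddLeftInvariant _)

/-- finiteness of the dilatation integral for the Gaussian density:
`∫ (f(m+θ(x-m))/f(x))^p f(x) dλ_d < ∞` iff `pθ² - p + 1 > 0`, i.e. iff `θ² > 1 - 1/p`. -/
theorem stmt11 (d : ℕ) (hd : 1 ≤ d) (m : Fin d → ℝ)
    (S : Matrix (Fin d) (Fin d) ℝ) (hS : S.PosDef)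
    (f : (Fin d → ℝ) → ℝ)
    (hf : ∀ x, f x = ((2 * π) ^ d * S.det) ^ (-(1 / 2 : ℝ)) *
      Real.exp (-((x - m) ⬝ᵥ S⁻¹.mulVec (x - m)) / 2))
    (θ p : ℝ) (hθ : 0 < θ) (hp : 1 < p) :
    (Integrable (fun x => (f (m + θ • (x - m)) / f x) ^ p * f x) volume ↔
      0 < p * θ ^ 2 - p + 1) ∧
    (0 < p * θ ^ 2 - p + 1 ↔ 1 - 1 / p < θ ^ 2) := by
  have hp0 : 0 < p := one_pos.trans hp
  constructor
  · have : Nonempty (Fin d) := ⟨⟨0, hd⟩⟩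
    set C : ℝ := ((2 * π) ^ d * S.det) ^ (-(1 / 2 : ℝ))
    have hC : 0 < C := Real.rpow_pos_of_pos (mul_pos (by positivity) hS.det_pos) _
    set g : (Fin d → ℝ) → ℝ := fun y =>
      Real.exp (-((p * θ ^ 2 - p + 1) / 2) * (y ⬝ᵥ S⁻¹ *ᵥ y))
    have hfg : (fun x => (f (m + θ • (x - m)) / f x) ^ p * f x) = fun x => C * g (x - m) := by
      funext x
      simp only [hf, g, add_sub_cancel_left, mulVec_smul, dotProduct_smul, smul_dotProduct,
        smul_eq_mul]
      rw [mul_div_mul_left _ _ hC.ne', ← Real.exp_sub, ← Real.exp_mul, mul_left_comm,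
        ← Real.exp_add]
      ring_nf
    have hshift : Integrable (fun x => g (x - m)) ↔ Integrable g :=
      ⟨fun h => by simpa using h.comp_add_right m, fun h => h.comp_sub_right m⟩
    rw [hfg, integrable_const_mul_iff hC.ne'.isUnit, hshift]
    refine ⟨fun h => ?_, fun h => hS.inv.integrable_exp_neg_mul (half_pos h)⟩
    by_contra! hle
    exact hS.inv.posSemidef.not_integrable_exp_neg_mul (by linarith) h
  · have key : p * θ ^ 2 - p + 1 = p * (θ ^ 2 - (1 - 1 / p)) := by
      field_simp
      ring
    rw [key, mul_pos_iff_of_pos_left hp0, sub_pos]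
end

section
/- Let f be the density of the d-dimensional Gaussian distribution N(m,Σ) (Σ symmetric positive definite). Let r > 0 and let (Γ^n)_{n≥1} be finite subsets of ℝ^d with card(Γ^n) = n whose empirical measures (1/n)∑_{x∈Γ^n} δ_x converge weakly to the probability measure with density f^{d/(d+r)} / ∫ f^{d/(d+r)} dλ_d. Then for every θ > 0, the empirical measures (1/n)∑_{x∈Γ^n} δ_{m+θ(x−m)} of the dilated grids Γ^n_{θ,m} = {m+θ(x−m) : x∈Γ^n} converge weakly to the probability measure with density f^{d/((d+r)θ²)} / ∫ f^{d/((d+r)θ²)} dλ_d. -/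
open MeasureTheory Matrix Real Filter

/-- The change of variables formula for the homothety with centre `m` and ratio `θ`. -/
theorem integral_comp_homothety {E : Type*} [NormedAddCommGroup E] [NormedSpace ℝ E]
    [MeasurableSpace E] [BorelSpace E] [FiniteDimensional ℝ E] (μ : Measure E)
    [μ.IsAddHaarMeasure] (H : E → ℝ) (m : E) (θ : ℝ) :
    ∫ x, H (m + θ • (x - m)) ∂μ = |(θ ^ Module.finrank ℝ E)⁻¹| * ∫ x, H x ∂μ := by
  rw [integral_sub_right_eq_self (fun x => H (m + θ • x)) m,
    Measure.integral_comp_smul μ (fun x => H (m + x)), integral_add_left_eq_self H m,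
    smul_eq_mul]

/-- A power of `c * exp (-q (x - m) / 2)`, with `q` homogeneous of degree two, is up to a constant
factor the power with exponent divided by `θ ^ 2`, evaluated at the dilated point. -/
theorem gaussian_rpow_eq_const_mul_rpow_homothety {ι : Type*} [Fintype ι] {c : ℝ} (hc : 0 < c)
    (A : Matrix ι ι ℝ) (m x : ι → ℝ) (p : ℝ) {θ : ℝ} (hθ : θ ≠ 0) {f : (ι → ℝ) → ℝ}
    (hf : ∀ x, f x = c * Real.exp (-((x - m) ⬝ᵥ A.mulVec (x - m)) / 2)) :
    f x ^ p = c ^ (p - p / θ ^ 2) * f (m + θ • (x - m)) ^ (p / θ ^ 2) := by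
  rw [hf, hf, Real.mul_rpow hc.le (Real.exp_pos _).le, Real.mul_rpow hc.le (Real.exp_pos _).le,
    ← mul_assoc, ← Real.rpow_add hc, sub_add_cancel, ← Real.exp_mul, ← Real.exp_mul,
    add_sub_cancel_left, Matrix.mulVec_smul, dotProduct_smul, smul_dotProduct]
  simp only [smul_eq_mul]
  congr 2
  field_simp

/-- if the empirical measures of grids `Γ^n` converge weakly to the measure
with density proportional to `f^{d/(d+r)}` (`f` Gaussian), then the empirical measures of
the dilated grids `Γ^n_{θ,m}` converge weakly to the measure with density proportional to
`f^{d/((d+r)θ²)}`. -/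
theorem stmt12 (d : ℕ) (hd : 1 ≤ d) (r θ : ℝ) (hr : 0 < r) (hθ : 0 < θ)
    (m : Fin d → ℝ) (S : Matrix (Fin d) (Fin d) ℝ) (hS : S.PosDef)
    (f : (Fin d → ℝ) → ℝ)
    (hf : ∀ x, f x = ((2 * π) ^ d * S.det) ^ (-(1 / 2 : ℝ)) *
      Real.exp (-((x - m) ⬝ᵥ S⁻¹.mulVec (x - m)) / 2))
    (Γ : ℕ → Finset (Fin d → ℝ)) (hcard : ∀ n, (Γ n).card = n)
    (hconv : ∀ g : (Fin d → ℝ) → ℝ, Continuous g → (∃ C, ∀ x, |g x| ≤ C) →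
      Tendsto (fun n : ℕ => (1 / (n : ℝ)) * ∑ x ∈ Γ n, g x) atTop
        (nhds ((∫ x, g x * f x ^ ((d : ℝ) / ((d : ℝ) + r))) /
          ∫ x, f x ^ ((d : ℝ) / ((d : ℝ) + r))))) :
    ∀ g : (Fin d → ℝ) → ℝ, Continuous g → (∃ C, ∀ x, |g x| ≤ C) →
      Tendsto (fun n : ℕ => (1 / (n : ℝ)) * ∑ x ∈ Γ n, g (m + θ • (x - m))) atTop
        (nhds ((∫ x, g x * f x ^ ((d : ℝ) / (((d : ℝ) + r) * θ ^ 2))) /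
          ∫ x, f x ^ ((d : ℝ) / (((d : ℝ) + r) * θ ^ 2)))) := by
  intro g hg ⟨C, hC⟩
  have hc : 0 < ((2 * π) ^ d * S.det) ^ (-(1 / 2 : ℝ)) :=
    Real.rpow_pos_of_pos (mul_pos (by positivity) hS.det_pos) _
  set p : ℝ := (d : ℝ) / ((d : ℝ) + r)
  have hp : (d : ℝ) / (((d : ℝ) + r) * θ ^ 2) = p / θ ^ 2 := (div_div _ _ _).symm
  rw [hp]
  obtain ⟨L, hL, h⟩ : ∃ L : ℝ, L ≠ 0 ∧ ∀ h : (Fin d → ℝ) → ℝ,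
      ∫ x, h (m + θ • (x - m)) * f x ^ p = L * ∫ x, h x * f x ^ (p / θ ^ 2) := by
    refine ⟨_ * |(θ ^ Module.finrank ℝ (Fin d → ℝ))⁻¹|,
      mul_ne_zero (Real.rpow_pos_of_pos hc (p - p / θ ^ 2)).ne' (by positivity), fun h => ?_⟩
    rw [mul_assoc, ← integral_comp_homothety volume (fun x => h x * f x ^ (p / θ ^ 2)) m θ,
      ← integral_const_mul]
    refine integral_congr_ae (ae_of_all _ fun x => ?_)
    simp only [gaussian_rpow_eq_const_mul_rpow_homothety hc S⁻¹ m x p hθ.ne' hf]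
    ring
  have h_one := h fun _ => 1
  simp only [one_mul] at h_one
  have key := hconv (fun x => g (m + θ • (x - m))) (by fun_prop) ⟨C, fun x => hC _⟩
  rwa [h g, h_one, mul_div_mul_left _ _ hL] at key
end

section
/- Let r, s > 0 and let f be the density of the d-dimensional Gaussian distribution N(m,Σ) (Σ symmetric positive definite). Let (Γ^n)_{n≥1} be finite subsets of ℝ^d with card(Γ^n) = n satisfying the L^r-empirical measure property for P = f·λ_d. Set θ* = √((d+s)/(d+r)). Then the dilated grids Γ^n_{θ*,m} = {m+θ*(x−m) : x∈Γ^n} satisfy the L^s-empirical measure property for P: the empirical measures (1/n)∑_{x∈Γ^n} δ_{m+θ*(x−m)} converge weakly to the probability measure with density f^{d/(d+s)} / ∫ f^{d/(d+s)} dλ_d. -/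
open MeasureTheory Matrix Real Filter

/-- The change of variables `y = m + c • (x - m)` in an integral over `ℝ^d`. -/
theorem integral_comp_dilation {d : ℕ} (F : (Fin d → ℝ) → ℝ) (m : Fin d → ℝ) (c : ℝ) :
    ∫ x, F (m + c • (x - m)) = |(c ^ d)⁻¹| * ∫ x, F x := by
  rw [integral_sub_right_eq_self (fun y => F (m + c • y)) m,
    Measure.integral_comp_smul volume (fun y => F (m + y)) c, integral_add_left_eq_self,
    Module.finrank_fin_fun, smul_eq_mul]

/-- A power of a Gaussian-type density `K * exp (-q (x - m) / 2)` is, up to a constant, another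
power of the same density after a dilation around `m`. -/
theorem gaussian_rpow_dilation {d : ℕ} (A : Matrix (Fin d) (Fin d) ℝ) (m : Fin d → ℝ)
    {K : ℝ} (hK : 0 < K) {a b c : ℝ} (hc : b * c ^ 2 = a) (x : Fin d → ℝ) :
    (K * Real.exp (-((x - m) ⬝ᵥ A.mulVec (x - m)) / 2)) ^ a =
      K ^ (a - b) * (K * Real.exp (-((m + c • (x - m) - m) ⬝ᵥ
        A.mulVec (m + c • (x - m) - m)) / 2)) ^ b := by
  rw [Real.mul_rpow hK.le (Real.exp_pos _).le, Real.mul_rpow hK.le (Real.exp_pos _).le,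
    ← mul_assoc, ← Real.rpow_add hK, sub_add_cancel, ← Real.exp_mul, ← Real.exp_mul,
    add_sub_cancel_left, Matrix.mulVec_smul, smul_dotProduct, dotProduct_smul, ← hc,
    smul_eq_mul, smul_eq_mul]
  ring_nf

/-- for the Gaussian `N(m,Σ)` density `f`, if the grids `Γ^n` satisfy the
`Lʳ`-empirical measure property, then the grids dilated by `θ* = √((d+s)/(d+r))` around `m`
satisfy the `Lˢ`-empirical measure property. -/
theorem stmt13 (d : ℕ) (hd : 1 ≤ d) (r s : ℝ) (hr : 0 < r) (hs : 0 < s)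
    (m : Fin d → ℝ) (S : Matrix (Fin d) (Fin d) ℝ) (hS : S.PosDef)
    (f : (Fin d → ℝ) → ℝ)
    (hf : ∀ x, f x = ((2 * π) ^ d * S.det) ^ (-(1 / 2 : ℝ)) *
      Real.exp (-((x - m) ⬝ᵥ S⁻¹.mulVec (x - m)) / 2))
    (Γ : ℕ → Finset (Fin d → ℝ)) (hcard : ∀ n, (Γ n).card = n)
    (hconv : ∀ g : (Fin d → ℝ) → ℝ, Continuous g → (∃ C, ∀ x, |g x| ≤ C) →
      Tendsto (fun n : ℕ => (1 / (n : ℝ)) * ∑ x ∈ Γ n, g x) atTop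
        (nhds ((∫ x, g x * f x ^ ((d : ℝ) / ((d : ℝ) + r))) /
          ∫ x, f x ^ ((d : ℝ) / ((d : ℝ) + r))))) :
    ∀ g : (Fin d → ℝ) → ℝ, Continuous g → (∃ C, ∀ x, |g x| ≤ C) →
      Tendsto
        (fun n : ℕ => (1 / (n : ℝ)) *
          ∑ x ∈ Γ n, g (m + Real.sqrt (((d : ℝ) + s) / ((d : ℝ) + r)) • (x - m)))
        atTop
        (nhds ((∫ x, g x * f x ^ ((d : ℝ) / ((d : ℝ) + s))) /
          ∫ x, f x ^ ((d : ℝ) / ((d : ℝ) + s)))) := by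
  intro g hg ⟨C, hC⟩
  set c : ℝ := Real.sqrt (((d : ℝ) + s) / ((d : ℝ) + r))
  have hc : 0 < c := Real.sqrt_pos.2 (by positivity)
  have hc2 : (d : ℝ) / (d + s) * c ^ 2 = d / (d + r) := by
    rw [Real.sq_sqrt (by positivity)]
    field_simp
  have hK : 0 < ((2 * π) ^ d * S.det) ^ (-(1 / 2 : ℝ)) := by
    have := hS.det_pos
    positivity
  have hrpow (x : Fin d → ℝ) := gaussian_rpow_dilation S⁻¹ m hK hc2 x
  simp only [← hf] at hrpow
  have hlim := hconv (fun x => g (m + c • (x - m))) (by fun_prop) ⟨C, fun x => hC _⟩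
  simp only [hrpow, mul_left_comm, integral_const_mul] at hlim
  rw [integral_comp_dilation (fun y => g y * f y ^ ((d : ℝ) / (d + s))),
    integral_comp_dilation (fun y => f y ^ ((d : ℝ) / (d + s))),
    mul_div_mul_left _ _ (Real.rpow_pos_of_pos hK _).ne',
    mul_div_mul_left _ _ (by positivity)] at hlim
  exact hlim
end

section
/- Let d ≥ 1, λ > 0, α > 0, and let f(x) = C e^{−λ|x|^α} be a probability density on ℝ^d w.r.t. λ_d (|·| the Euclidean norm, C the normalizing constant). Let r, s > 0 and let (Γ^n)_{n≥1} be finite subsets of ℝ^d with card(Γ^n) = n satisfying the L^r-empirical measure property for P = f·λ_d. Set θ* = ((d+s)/(d+r))^{1/α}. Then the dilated grids θ*Γ^n = {θ*x : x∈Γ^n} satisfy the L^s-empirical measure property for P: the empirical measures (1/n)∑_{x∈Γ^n} δ_{θ*x} converge weakly to the probability measure with density f^{d/(d+s)} / ∫ f^{d/(d+s)} dλ_d. -/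
open MeasureTheory Real Filter

/-- for the hyper-exponential probability density `f(x) = C e^{-λ|x|^α}` on
`ℝ^d`, if the grids `Γ^n` satisfy the `Lʳ`-empirical measure property, then the grids
dilated by `θ* = ((d+s)/(d+r))^{1/α}` satisfy the `Lˢ`-empirical measure property. -/
theorem stmt15 (d : ℕ) (hd : 1 ≤ d) (lam α C : ℝ)
    (hlam : 0 < lam) (hα : 0 < α) (hC : 0 < C)
    (f : EuclideanSpace ℝ (Fin d) → ℝ)
    (hf : ∀ x, f x = C * Real.exp (-lam * ‖x‖ ^ α))
    (hprob : ∫ x, f x = 1)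
    (r s : ℝ) (hr : 0 < r) (hs : 0 < s)
    (Γ : ℕ → Finset (EuclideanSpace ℝ (Fin d))) (hcard : ∀ n, (Γ n).card = n)
    (hconv : ∀ g : EuclideanSpace ℝ (Fin d) → ℝ, Continuous g → (∃ B, ∀ x, |g x| ≤ B) →
      Tendsto (fun n : ℕ => (1 / (n : ℝ)) * ∑ x ∈ Γ n, g x) atTop
        (nhds ((∫ x, g x * f x ^ ((d : ℝ) / ((d : ℝ) + r))) /
          ∫ x, f x ^ ((d : ℝ) / ((d : ℝ) + r))))) :
    ∀ g : EuclideanSpace ℝ (Fin d) → ℝ, Continuous g → (∃ B, ∀ x, |g x| ≤ B) →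
      Tendsto
        (fun n : ℕ => (1 / (n : ℝ)) *
          ∑ x ∈ Γ n, g ((((d : ℝ) + s) / ((d : ℝ) + r)) ^ (1 / α) • x))
        atTop
        (nhds ((∫ x, g x * f x ^ ((d : ℝ) / ((d : ℝ) + s))) /
          ∫ x, f x ^ ((d : ℝ) / ((d : ℝ) + s)))) := by
  intro g hg hgB
  have hd0 : (0 : ℝ) < d := by exact_mod_cast hd
  set θ : ℝ := (((d : ℝ) + s) / ((d : ℝ) + r)) ^ (1 / α) with hθ
  have hθ0 : 0 < θ := by positivity
  have hθα : θ ^ α = ((d : ℝ) + s) / ((d : ℝ) + r) := by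
    rw [hθ, one_div, Real.rpow_inv_rpow (by positivity) hα.ne']
  obtain ⟨B, hB⟩ := hgB
  have key := hconv (fun x => g (θ • x)) (by fun_prop) ⟨B, fun x => hB _⟩
  obtain ⟨K, hK, hfK⟩ : ∃ K : ℝ, K ≠ 0 ∧ ∀ x, f x ^ ((d : ℝ) / ((d : ℝ) + r)) =
      K * f (θ • x) ^ ((d : ℝ) / ((d : ℝ) + s)) := by
    refine ⟨C ^ ((d : ℝ) / ((d : ℝ) + r)) / C ^ ((d : ℝ) / ((d : ℝ) + s)),
      by positivity, fun x => ?_⟩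
    have hexp : -lam * ‖x‖ ^ α * ((d : ℝ) / ((d : ℝ) + r)) =
        -lam * ‖θ • x‖ ^ α * ((d : ℝ) / ((d : ℝ) + s)) := by
      rw [norm_smul, Real.norm_of_nonneg hθ0.le,
        Real.mul_rpow hθ0.le (norm_nonneg _), hθα]
      field_simp
    rw [hf, hf, Real.mul_rpow hC.le (Real.exp_pos _).le,
      Real.mul_rpow hC.le (Real.exp_pos _).le, ← Real.exp_mul, ← Real.exp_mul, hexp]
    field_simp
  have hint : ∀ h : EuclideanSpace ℝ (Fin d) → ℝ,
      ∫ x, h (θ • x) * f x ^ ((d : ℝ) / ((d : ℝ) + r)) =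
        K * |(θ ^ d)⁻¹| * ∫ x, h x * f x ^ ((d : ℝ) / ((d : ℝ) + s)) := by
    intro h
    have hscale := Measure.integral_comp_smul volume
      (fun x => h x * f x ^ ((d : ℝ) / ((d : ℝ) + s))) θ
    rw [finrank_euclideanSpace_fin, smul_eq_mul] at hscale
    rw [mul_assoc, ← hscale, ← integral_const_mul]
    simp only [hfK, mul_left_comm]
  have hone := hint fun _ => 1
  simp only [one_mul] at hone
  have hc : K * |(θ ^ d)⁻¹| ≠ 0 := by positivity
  rwa [hint g, hone, mul_div_mul_left _ _ hc] at key
end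

section
/- Let d ≥ 1, λ > 0, α > 0, r, s > 0, and let f(x) = e^{−λ|x|^α} on ℝ^d (|·| the Euclidean norm). Set θ* = ((d+s)/(d+r))^{1/α}. Then (θ*)^{s+d} · (∫_{ℝ^d} f(x)^{d/(d+r)} dλ_d(x))^{s/d} · ∫_{ℝ^d} f(x)^{−s/(d+r)} f(θ* x) dλ_d(x) = (∫_{ℝ^d} f(x)^{d/(d+s)} dλ_d(x))^{(d+s)/d}. (All the integrals appearing are finite.) -/
open MeasureTheory Real

theorem integrable_exp_neg_mul_norm_rpow {d : ℕ} (hd : 1 ≤ d) {b α : ℝ}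
    (hb : 0 < b) (hα : 0 < α) :
    Integrable (fun x : EuclideanSpace ℝ (Fin d) => Real.exp (-b * ‖x‖ ^ α)) volume := by
  have : Nonempty (Fin d) := ⟨⟨0, hd⟩⟩
  rw [integrable_fun_norm_addHaar volume (f := fun t : ℝ => Real.exp (-b * t ^ α))]
  have h := integrableOn_rpow_mul_exp_neg_mul_rpow (p := α) (s := ((d - 1 : ℕ) : ℝ)) (b := b)
    (by linarith [Nat.cast_nonneg (α := ℝ) (d - 1)]) hα hb
  simpa [Real.rpow_natCast] using h

theorem integral_exp_neg_mul_norm_rpow_scale {d : ℕ} {b c θ α : ℝ} (hθ : 0 < θ)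
    (h : c = b * θ ^ α) :
    ∫ x : EuclideanSpace ℝ (Fin d), Real.exp (-c * ‖x‖ ^ α) =
      (θ ^ d)⁻¹ * ∫ x : EuclideanSpace ℝ (Fin d), Real.exp (-b * ‖x‖ ^ α) := by
  have key := Measure.integral_comp_smul_of_nonneg volume
    (fun x : EuclideanSpace ℝ (Fin d) => Real.exp (-b * ‖x‖ ^ α)) θ (hR := hθ.le)
  rw [finrank_euclideanSpace_fin, smul_eq_mul] at key
  rw [← key]
  refine integral_congr_ae (.of_forall fun x => ?_)
  simp only [norm_smul, Real.norm_eq_abs, abs_of_pos hθ,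
    Real.mul_rpow hθ.le (norm_nonneg x), h]
  ring_nf

/-- for `f(x) = e^{-λ|x|^α}` and `θ* = ((d+s)/(d+r))^{1/α}`, the identity
`(θ*)^{s+d} (∫ f^{d/(d+r)})^{s/d} ∫ f^{-s/(d+r)} f(θ* x) dx = (∫ f^{d/(d+s)})^{(d+s)/d}`,
all integrals being finite. -/
theorem stmt16 (d : ℕ) (hd : 1 ≤ d) (lam α r s : ℝ)
    (hlam : 0 < lam) (hα : 0 < α) (hr : 0 < r) (hs : 0 < s)
    (f : EuclideanSpace ℝ (Fin d) → ℝ)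
    (hf : ∀ x, f x = Real.exp (-lam * ‖x‖ ^ α)) :
    Integrable (fun x => f x ^ ((d : ℝ) / ((d : ℝ) + r))) volume ∧
    Integrable
      (fun x => f x ^ (-(s / ((d : ℝ) + r))) *
        f ((((d : ℝ) + s) / ((d : ℝ) + r)) ^ (1 / α) • x)) volume ∧
    Integrable (fun x => f x ^ ((d : ℝ) / ((d : ℝ) + s))) volume ∧
    ((((d : ℝ) + s) / ((d : ℝ) + r)) ^ (1 / α)) ^ (s + (d : ℝ)) *
        (∫ x, f x ^ ((d : ℝ) / ((d : ℝ) + r))) ^ (s / (d : ℝ)) *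
        ∫ x, f x ^ (-(s / ((d : ℝ) + r))) *
          f ((((d : ℝ) + s) / ((d : ℝ) + r)) ^ (1 / α) • x) =
      (∫ x, f x ^ ((d : ℝ) / ((d : ℝ) + s))) ^ (((d : ℝ) + s) / (d : ℝ)) := by
  have hd0 : (0 : ℝ) < d := by exact_mod_cast hd
  have hdr : 0 < (d : ℝ) + r := by positivity
  have hds : 0 < (d : ℝ) + s := by positivity
  set θ : ℝ := (((d : ℝ) + s) / ((d : ℝ) + r)) ^ (1 / α) with hθdef
  have hθ : 0 < θ := by positivity
  have hθα : θ ^ α = ((d : ℝ) + s) / ((d : ℝ) + r) := by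
    rw [hθdef, ← Real.rpow_mul (by positivity), one_div_mul_cancel hα.ne', Real.rpow_one]
  have hpow (p : ℝ) (x : EuclideanSpace ℝ (Fin d)) :
      f x ^ p = Real.exp (-(lam * p) * ‖x‖ ^ α) := by
    rw [hf, ← Real.exp_mul]
    ring_nf
  have hdil (x : EuclideanSpace ℝ (Fin d)) :
      f x ^ (-(s / ((d : ℝ) + r))) * f (θ • x) =
        Real.exp (-(lam * ((d : ℝ) / ((d : ℝ) + r))) * ‖x‖ ^ α) := by
    rw [hpow, hf, ← Real.exp_add, norm_smul, Real.norm_eq_abs, abs_of_pos hθ,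
      Real.mul_rpow hθ.le (norm_nonneg x), hθα]
    congr 1
    field_simp
    ring
  simp only [hdil]
  simp only [hpow]
  refine ⟨integrable_exp_neg_mul_norm_rpow hd (by positivity) hα,
    integrable_exp_neg_mul_norm_rpow hd (by positivity) hα,
    integrable_exp_neg_mul_norm_rpow hd (by positivity) hα, ?_⟩
  rw [integral_exp_neg_mul_norm_rpow_scale (b := lam * ((d : ℝ) / ((d : ℝ) + s))) hθ
    (by rw [hθα]; field_simp)]
  set B := ∫ x : EuclideanSpace ℝ (Fin d),
    Real.exp (-(lam * ((d : ℝ) / ((d : ℝ) + s))) * ‖x‖ ^ α)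
  have hB : 0 ≤ B := integral_nonneg fun x => (Real.exp_pos _).le
  have hexp : s / (d : ℝ) + 1 = ((d : ℝ) + s) / d := by
    field_simp
    ring
  have hθpow : ((θ ^ d)⁻¹) ^ (((d : ℝ) + s) / d) = (θ ^ (s + (d : ℝ)))⁻¹ := by
    rw [Real.inv_rpow (by positivity), ← Real.rpow_natCast, ← Real.rpow_mul hθ.le,
      mul_div_cancel₀ _ hd0.ne', add_comm]
  rw [mul_assoc, ← Real.rpow_add_one' (by positivity) (by positivity), hexp,
    Real.mul_rpow (by positivity) hB, hθpow, mul_inv_cancel_left₀ (by positivity)]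
end

section
/- Let d ≥ 1, λ > 0, α > 0, β > −d, and let f(x) = C|x|^β e^{−λ|x|^α} on ℝ^d, where |·| is the Euclidean norm and C > 0 is any constant. Then for every 0 < s < r and every θ > 0: ∫_{ℝ^d} f(x)^{−s/(r−s)} f(θx)^{r/(r−s)} dλ_d(x) < ∞ if and only if θ^α > s/r. -/
open MeasureTheory Real

/-- A power times a stretched exponential is integrable on the half-line exactly when the
exponential decays. -/
lemma integrableOn_Ioi_rpow_mul_exp_neg_mul_rpow_iff {p q b : ℝ} (hq : -1 < q) (hp : 0 < p) :
    IntegrableOn (fun y : ℝ => y ^ q * Real.exp (-b * y ^ p)) (Set.Ioi 0) ↔ 0 < b := by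
  refine ⟨fun h => ?_, fun hb => integrableOn_rpow_mul_exp_neg_mul_rpow hq hp hb⟩
  by_contra! hb
  refine not_integrableOn_Ioi_rpow q (Integrable.mono' h ?_ ?_)
  · exact (measurable_id.pow_const q).aestronglyMeasurable
  · refine (ae_restrict_iff' measurableSet_Ioi).2 (Filter.Eventually.of_forall fun y hy => ?_)
    have hy0 : (0 : ℝ) < y := hy
    rw [Real.norm_of_nonneg (by positivity)]
    refine le_mul_of_one_le_right (by positivity) (Real.one_le_exp ?_)
    exact mul_nonneg (by linarith) (by positivity)

/-- The radial function `|x|^β e^{-b|x|^α}` on `ℝ^d`, with `β > -d`, is integrable exactly when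
`b > 0`. -/
lemma integrable_norm_rpow_mul_exp_neg_mul_norm_rpow_iff {d : ℕ} (hd : 1 ≤ d) {α β b : ℝ}
    (hα : 0 < α) (hβ : -(d : ℝ) < β) :
    Integrable (fun x : EuclideanSpace ℝ (Fin d) => ‖x‖ ^ β * Real.exp (-b * ‖x‖ ^ α)) volume ↔
      0 < b := by
  have : Nonempty (Fin d) := ⟨⟨0, hd⟩⟩
  rw [integrable_fun_norm_addHaar (μ := (volume : Measure (EuclideanSpace ℝ (Fin d))))
    (f := fun y : ℝ => y ^ β * Real.exp (-b * y ^ α)), finrank_euclideanSpace_fin,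
    ← integrableOn_Ioi_rpow_mul_exp_neg_mul_rpow_iff
      (q := (d : ℝ) - 1 + β) (by linarith) hα]
  refine integrableOn_congr_fun (fun y hy => ?_) measurableSet_Ioi
  have hy0 : (0 : ℝ) < y := hy
  rw [smul_eq_mul, ← mul_assoc, Real.rpow_add hy0, ← Real.rpow_natCast, Nat.cast_sub hd,
    Nat.cast_one]

/-- for the hyper-Gamma density `f(x) = C|x|^β e^{-λ|x|^α}` on `ℝ^d`,
`∫ f(x)^{-s/(r-s)} f(θx)^{r/(r-s)} dλ_d(x) < ∞` iff `θ^α > s/r`. -/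
theorem stmt17 (d : ℕ) (hd : 1 ≤ d) (lam α β C : ℝ)
    (hlam : 0 < lam) (hα : 0 < α) (hβ : -(d : ℝ) < β) (hC : 0 < C)
    (f : EuclideanSpace ℝ (Fin d) → ℝ)
    (hf : ∀ x, f x = C * ‖x‖ ^ β * Real.exp (-lam * ‖x‖ ^ α))
    (s r θ : ℝ) (hs : 0 < s) (hsr : s < r) (hθ : 0 < θ) :
    Integrable (fun x => f x ^ (-(s / (r - s))) * f (θ • x) ^ (r / (r - s))) volume ↔
      s / r < θ ^ α := by
  have : Nonempty (Fin d) := ⟨⟨0, hd⟩⟩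
  have hrs : 0 < r - s := sub_pos.2 hsr
  have hr : 0 < r := hs.trans hsr
  have key : (fun x => f x ^ (-(s / (r - s))) * f (θ • x) ^ (r / (r - s))) =ᵐ[volume]
      fun x => (C * (θ ^ β) ^ (r / (r - s))) *
        (‖x‖ ^ β * Real.exp (-(lam / (r - s) * (r * θ ^ α - s)) * ‖x‖ ^ α)) := by
    filter_upwards [Measure.ae_ne volume (0 : EuclideanSpace ℝ (Fin d))] with x hx
    have hx0 : 0 < ‖x‖ := norm_pos_iff.2 hx
    set A := C * ‖x‖ ^ β with hA
    have hA0 : 0 < A := by positivity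
    have hfx : f (θ • x) = θ ^ β * A * Real.exp (-lam * (θ ^ α * ‖x‖ ^ α)) := by
      rw [hf, norm_smul, Real.norm_of_nonneg hθ.le, Real.mul_rpow hθ.le hx0.le,
        Real.mul_rpow hθ.le hx0.le, hA]
      ring
    have hpow : A ^ (-(s / (r - s))) * A ^ (r / (r - s)) = A := by
      rw [← Real.rpow_add hA0, show -(s / (r - s)) + r / (r - s) = 1 by field_simp; ring,
        Real.rpow_one]
    have hexp : Real.exp (-lam * ‖x‖ ^ α * -(s / (r - s))) *
        Real.exp (-lam * (θ ^ α * ‖x‖ ^ α) * (r / (r - s))) =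
        Real.exp (-(lam / (r - s) * (r * θ ^ α - s)) * ‖x‖ ^ α) := by
      rw [← Real.exp_add]
      congr 1
      field_simp
      ring
    rw [hfx, hf x, ← hA, Real.mul_rpow hA0.le (Real.exp_pos _).le,
      Real.mul_rpow (by positivity) (Real.exp_pos _).le,
      Real.mul_rpow (by positivity) hA0.le, ← Real.exp_mul, ← Real.exp_mul, ← hexp]
    calc _ = (A ^ (-(s / (r - s))) * A ^ (r / (r - s))) * (θ ^ β) ^ (r / (r - s)) *
          (Real.exp (-lam * ‖x‖ ^ α * -(s / (r - s))) *
            Real.exp (-lam * (θ ^ α * ‖x‖ ^ α) * (r / (r - s)))) := by ring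
      _ = _ := by rw [hpow, hA]; ring
  have hK : C * (θ ^ β) ^ (r / (r - s)) ≠ 0 := by positivity
  rw [integrable_congr key, integrable_const_mul_iff hK.isUnit,
    integrable_norm_rpow_mul_exp_neg_mul_norm_rpow_iff hd hα hβ,
    mul_pos_iff_of_pos_left (div_pos hlam hrs), sub_pos, div_lt_iff₀' hr]
end

section
/- Let d ≥ 1, λ > 0, α > 0, β > −d, and let f(x) = C|x|^β e^{−λ|x|^α} on ℝ^d, where |·| is the Euclidean norm and C > 0 is any constant. Then for every θ > 0 and every real ρ > 1: ∫_{{x : f(x)>0}} (f(θx)/f(x))^ρ f(x) dλ_d(x) < ∞ if and only if ρθ^α − ρ + 1 > 0, i.e. if and only if θ^α > 1 − 1/ρ. (In particular, with ρ = (1−q)q' for q = −s/(d+r−s) and q' > 1, letting q' ↓ 1 yields that the dilated grids are L^s-rate optimal exactly for θ^α > s/(d+r).) -/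
open MeasureTheory Real

theorem integrableOn_rpow_mul_exp_neg_mul_rpow_iff {p s b : ℝ} (hs : -1 < s) (hp : 0 < p) :
    IntegrableOn (fun r : ℝ => r ^ s * exp (-b * r ^ p)) (Set.Ioi 0) ↔ 0 < b := by
  refine ⟨fun h => ?_, integrableOn_rpow_mul_exp_neg_mul_rpow hs hp⟩
  by_contra! hb
  have key : IntegrableOn (fun r : ℝ => r ^ s) (Set.Ioi 1) := by
    refine (h.mono_set (Set.Ioi_subset_Ioi zero_le_one)).mono' (by fun_prop) ?_
    filter_upwards [ae_restrict_mem measurableSet_Ioi] with r hr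
    have hr0 : (0 : ℝ) < r := zero_lt_one.trans hr
    rw [norm_of_nonneg (by positivity)]
    refine le_mul_of_one_le_right (by positivity) (one_le_exp ?_)
    have : 0 < r ^ p := by positivity
    nlinarith
  rw [integrableOn_Ioi_rpow_iff zero_lt_one] at key
  linarith

/-- The power-weighted dilation ratio of a hyper-Gamma density is again of hyper-Gamma form. -/
theorem hyperGamma_dilation_ratio_rpow_mul {lam α β C θ ρ t : ℝ} (hC : 0 < C) (hθ : 0 < θ)
    (ht : 0 < t) :
    (C * (θ * t) ^ β * exp (-lam * (θ * t) ^ α) / (C * t ^ β * exp (-lam * t ^ α))) ^ ρ *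
        (C * t ^ β * exp (-lam * t ^ α)) =
      ((θ ^ β) ^ ρ * C) * (t ^ β * exp (-(lam * (ρ * θ ^ α - ρ + 1)) * t ^ α)) := by
  have hratio : C * (θ * t) ^ β * exp (-lam * (θ * t) ^ α) / (C * t ^ β * exp (-lam * t ^ α)) =
      θ ^ β * exp (-lam * (θ ^ α - 1) * t ^ α) := by
    have h : exp (-lam * (θ * t) ^ α) =
        exp (-lam * (θ ^ α - 1) * t ^ α) * exp (-lam * t ^ α) := by
      rw [← exp_add, mul_rpow hθ.le ht.le]
      ring_nf
    have : t ^ β ≠ 0 := by positivity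
    rw [h, mul_rpow hθ.le ht.le]
    field_simp
  have hexp : exp (-(lam * (ρ * θ ^ α - ρ + 1)) * t ^ α) =
      exp (-lam * (θ ^ α - 1) * t ^ α * ρ) * exp (-lam * t ^ α) := by
    rw [← exp_add]
    ring_nf
  rw [hratio, mul_rpow (by positivity) (by positivity), ← exp_mul, hexp]
  ring

/-- for the hyper-Gamma density `f(x) = C|x|^β e^{-λ|x|^α}` on `ℝ^d` and any
`ρ > 1`, `∫_{f>0} (f(θx)/f(x))^ρ f(x) dλ_d(x) < ∞` iff `ρθ^α - ρ + 1 > 0`, i.e. iff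
`θ^α > 1 - 1/ρ`. -/
theorem stmt18 (d : ℕ) (hd : 1 ≤ d) (lam α β C : ℝ)
    (hlam : 0 < lam) (hα : 0 < α) (hβ : -(d : ℝ) < β) (hC : 0 < C)
    (f : EuclideanSpace ℝ (Fin d) → ℝ)
    (hf : ∀ x, f x = C * ‖x‖ ^ β * Real.exp (-lam * ‖x‖ ^ α))
    (θ ρ : ℝ) (hθ : 0 < θ) (hρ : 1 < ρ) :
    (IntegrableOn (fun x => (f (θ • x) / f x) ^ ρ * f x) {x | 0 < f x} volume ↔
      0 < ρ * θ ^ α - ρ + 1) ∧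
    (0 < ρ * θ ^ α - ρ + 1 ↔ 1 - 1 / ρ < θ ^ α) := by
  have hρ0 : 0 < ρ := by linarith
  refine ⟨?_, ?_⟩
  · have : Nonempty (Fin d) := ⟨⟨0, hd⟩⟩
    have hne : ∀ᵐ x : EuclideanSpace ℝ (Fin d), x ≠ 0 := by
      simp [ae_iff]
    have hpos : ∀ x, x ≠ 0 → 0 < f x := fun x hx => by
      have : 0 < ‖x‖ := norm_pos_iff.mpr hx
      rw [hf]
      positivity
    have hset : {x | 0 < f x} =ᵐ[volume] Set.univ :=
      Filter.eventuallyEq_univ.mpr (hne.mono hpos)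
    set b := lam * (ρ * θ ^ α - ρ + 1) with hb
    have hfun : (fun x => (f (θ • x) / f x) ^ ρ * f x) =ᵐ[volume]
        fun x => ((θ ^ β) ^ ρ * C) * (‖x‖ ^ β * exp (-b * ‖x‖ ^ α)) := by
      filter_upwards [hne] with x hx
      rw [hf, hf, norm_smul, norm_of_nonneg hθ.le]
      exact hyperGamma_dilation_ratio_rpow_mul hC hθ (norm_pos_iff.mpr hx)
    have hc : IsUnit ((θ ^ β) ^ ρ * C) := (by positivity : (θ ^ β) ^ ρ * C ≠ 0).isUnit
    rw [integrableOn_congr_set_ae hset, integrableOn_univ, integrable_congr hfun,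
      integrable_const_mul_iff hc,
      integrable_fun_norm_addHaar volume (f := fun r : ℝ => r ^ β * exp (-b * r ^ α)),
      finrank_euclideanSpace_fin]
    have hrad : Set.EqOn (fun r : ℝ => r ^ (d - 1) • (r ^ β * exp (-b * r ^ α)))
        (fun r => r ^ ((d : ℝ) - 1 + β) * exp (-b * r ^ α)) (Set.Ioi 0) := fun r hr => by
      have h : r ^ (d - 1) = r ^ ((d : ℝ) - 1) := by
        rw [← rpow_natCast, Nat.cast_sub hd, Nat.cast_one]
      simp only [smul_eq_mul]
      rw [h, ← mul_assoc, ← rpow_add hr]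
    rw [integrableOn_congr_fun hrad measurableSet_Ioi,
      integrableOn_rpow_mul_exp_neg_mul_rpow_iff (by linarith) hα, hb,
      mul_pos_iff_of_pos_left hlam]
  · rw [sub_lt_comm, lt_div_iff₀ hρ0]
    constructor <;> intro h <;> linarith
end
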